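/- Let (ℕ₀, b, m) be a birth-death chain and W : ℕ₀ → ℝ be such that L_c + W is semi-bounded with lower bound K ∈ ℝ. Let v : ℕ₀ → ℝ with v(x) > 0 for all x satisfy Δv(x) + W(x)v(x) = λ·v(x) for all x ∈ ℕ₀, where λ < K. Then the following are equivalent: (1) Σ_{r=0}^∞ (Σ_{k=0}^r 1/(b(k,k+1)·v(k)·v(k+1)))² · v(r+1)² · m(r+1) = ∞; (2) for every μ < K, every u ∈ ℓ²(ℕ₀,m) satisfying Δu(x) + W(x)u(x) = μ·u(x) for all x ∈ ℕ₀ is identically zero. -/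

import Mathlib

/-- The formal Laplacian of a birth-death chain `(ℕ, b, m)` acting on `f : ℕ → ℝ`. -/
noncomputable def lap (b : ℕ → ℕ → ℝ) (m : ℕ → ℝ) (f : ℕ → ℝ) : ℕ → ℝ
  | 0 => (1 / m 0) * (b 0 1 * (f 0 - f 1))
  | (x + 1) => (1 / m (x + 1)) *
      (b (x + 1) (x + 2) * (f (x + 1) - f (x + 2)) + b (x + 1) x * (f (x + 1) - f x))

/-- The Schrödinger operator `L_c + W = (Δ + W)|_{C_c}` is semi-bounded with lower bound `K`:
`⟨(Δ+W)φ, φ⟩ ≥ K ⟨φ, φ⟩` for all finitely supported `φ`. -/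
noncomputable def SemiboundedBelow (b : ℕ → ℕ → ℝ) (m W : ℕ → ℝ) (K : ℝ) : Prop :=
  ∀ φ : ℕ → ℝ, (Function.support φ).Finite →
    K * ∑' x, φ x ^ 2 * m x ≤ ∑' x, (lap b m φ x + W x * φ x) * φ x * m x

section BirthDeath

variable {b : ℕ → ℕ → ℝ} {m W : ℕ → ℝ}

/-- The discrete Green (Wronskian) identity for two eigensolutions on an initial segment. -/
lemma wronskian_eq_sum (hsymm : ∀ x y, b x y = b y x) (hm : ∀ x, 0 < m x) {lam mu : ℝ}
    {u w : ℕ → ℝ} (hu : ∀ x, lap b m u x + W x * u x = mu * u x)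
    (hw : ∀ x, lap b m w x + W x * w x = lam * w x) (x : ℕ) :
    b x (x + 1) * (u x * w (x + 1) - w x * u (x + 1)) =
      (mu - lam) * ∑ k ∈ Finset.range (x + 1), u k * w k * m k := by
  induction x with
  | zero =>
    have h1 := hu 0
    have h2 := hw 0
    have := (hm 0).ne'
    simp only [lap] at h1 h2
    field_simp at h1 h2
    simp only [zero_add, Finset.sum_range_one]
    linear_combination w 0 * h1 - u 0 * h2
  | succ x ih =>
    have h1 := hu (x + 1)
    have h2 := hw (x + 1)
    have := (hm (x + 1)).ne'
    simp only [lap] at h1 h2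
    field_simp at h1 h2
    rw [Finset.sum_range_succ, mul_add, ← ih, hsymm x (x + 1)]
    linear_combination w (x + 1) * h1 - u (x + 1) * h2

lemma lap_const_mul (c : ℝ) (u : ℕ → ℝ) (x : ℕ) :
    lap b m (fun y => c * u y) x = c * lap b m u x := by
  cases x <;> simp only [lap] <;> ring

/-- The eigensolution of the three-term recurrence normalized to be `1` at the root. -/
noncomputable def eigensolution (b : ℕ → ℕ → ℝ) (m W : ℕ → ℝ) (mu : ℝ) : ℕ → ℝ
  | 0 => 1
  | 1 => 1 - m 0 * (mu - W 0) / b 0 1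
  | (x + 2) => eigensolution b m W mu (x + 1) +
      (b (x + 1) x * (eigensolution b m W mu (x + 1) - eigensolution b m W mu x)
        - m (x + 1) * (mu - W (x + 1)) * eigensolution b m W mu (x + 1)) / b (x + 1) (x + 2)

lemma eigensolution_spec (hb : ∀ x, 0 < b x (x + 1)) (hm : ∀ x, 0 < m x) (mu : ℝ) (x : ℕ) :
    lap b m (eigensolution b m W mu) x + W x * eigensolution b m W mu x =
      mu * eigensolution b m W mu x := by
  cases x with
  | zero =>
    have h1 := (hb 0).ne'
    have h2 := (hm 0).ne'
    simp only [zero_add] at h1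
    simp only [lap, eigensolution]
    field_simp
    ring
  | succ x =>
    have h1 : b (x + 1) (x + 2) ≠ 0 := (hb (x + 1)).ne'
    have h2 := (hm (x + 1)).ne'
    simp only [lap, eigensolution]
    field_simp
    ring

/-- Below the lower bound of the form, an eigensolution that is positive at the root is positive. -/
lemma SemiboundedBelow.eigensolution_pos {K : ℝ} (hsb : SemiboundedBelow b m W K)
    (hb : ∀ x, 0 < b x (x + 1)) (hm : ∀ x, 0 < m x) {mu : ℝ} (hmu : mu < K) {u : ℕ → ℝ}
    (hu : ∀ x, lap b m u x + W x * u x = mu * u x) (h0 : 0 < u 0) (x : ℕ) : 0 < u x := by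
  induction x using Nat.strong_induction_on with
  | _ n ih =>
    by_contra hn
    push Not at hn
    let φ : ℕ → ℝ := fun x => if x < n then u x else 0
    have hlt {x} (hx : x < n) : φ x = u x := if_pos hx
    have hge {x} (hx : ¬ x < n) : φ x = 0 := if_neg hx
    have hφu {x} (hx : x ≤ n) : u x ≤ φ x := by
      by_cases h : x < n
      · exact (hlt h).ge
      · rw [hge h, show x = n by omega]; exact hn
    have hnpos : 0 < n := by
      rcases Nat.eq_zero_or_pos n with rfl | h
      · exact absurd h0 hn.not_gt
      · exact h
    have hsupp : (Function.support φ).Finite := (Finset.range n).finite_toSet.subset fun x hx => by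
      by_contra h
      exact hx (hge (by simpa using h))
    have hlap {x} (hx : x < n) : lap b m φ x ≤ lap b m u x := by
      cases x with
      | zero =>
        simp only [lap, hlt hx]
        have := hφu (x := 1) (by omega)
        have := (hm 0).le
        have := (hb 0).le
        simp only [zero_add] at this
        gcongr
      | succ x =>
        simp only [lap, hlt hx, hlt (show x < n by omega)]
        have := hφu (x := x + 2) (by omega)
        have := (hm (x + 1)).le
        have : 0 ≤ b (x + 1) (x + 2) := (hb (x + 1)).le
        gcongr
    have key := hsb φ hsupp
    rw [tsum_eq_sum (s := Finset.range n) fun x hx => by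
        rw [hge (by simpa using hx)]; ring,
      tsum_eq_sum (s := Finset.range n) fun x hx => by
        rw [hge (by simpa using hx)]; ring] at key
    have hle : ∑ x ∈ Finset.range n, (lap b m φ x + W x * φ x) * φ x * m x ≤
        mu * ∑ x ∈ Finset.range n, φ x ^ 2 * m x := by
      rw [Finset.mul_sum]
      refine Finset.sum_le_sum fun x hx => ?_
      have hx : x < n := by simpa using hx
      have h1 : lap b m φ x + W x * φ x ≤ mu * φ x := by
        rw [hlt hx, ← hu x]
        linarith [hlap hx]
      have h2 : 0 ≤ φ x := by rw [hlt hx]; exact (ih x hx).le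
      calc _ ≤ mu * φ x * φ x * m x := by
            have := (hm x).le
            gcongr
        _ = _ := by ring
    have hpos : 0 < ∑ x ∈ Finset.range n, φ x ^ 2 * m x := by
      refine Finset.sum_pos (fun x hx => ?_) ⟨0, by simpa using hnpos⟩
      have hx : x < n := by simpa using hx
      rw [hlt hx]
      exact mul_pos (pow_pos (ih x hx) 2) (hm x)
    nlinarith

/-- Below the lower bound of the form, positive eigensolutions have finite total resistance. -/
lemma SemiboundedBelow.exists_resistance_le {K : ℝ} (hsb : SemiboundedBelow b m W K)
    (hsymm : ∀ x y, b x y = b y x) (hb : ∀ x, 0 < b x (x + 1)) (hm : ∀ x, 0 < m x) {mu : ℝ}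
    (hmu : mu < K) {u : ℕ → ℝ} (hu : ∀ x, lap b m u x + W x * u x = mu * u x)
    (hpos : ∀ x, 0 < u x) :
    ∃ C, ∀ n, ∑ k ∈ Finset.range n, 1 / (b k (k + 1) * u k * u (k + 1)) ≤ C := by
  obtain ⟨nu, hnu, hnuK⟩ := exists_between hmu
  obtain ⟨w, hw, hwpos⟩ : ∃ w : ℕ → ℝ, (∀ x, lap b m w x + W x * w x = nu * w x) ∧
      ∀ x, 0 < w x :=
    ⟨_, eigensolution_spec hb hm nu, hsb.eigensolution_pos hb hm hnuK
      (eigensolution_spec hb hm nu) (by simp [eigensolution])⟩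
  set c := (nu - mu) * (w 0 * u 0 * m 0) with hc
  have hcpos : 0 < c :=
    mul_pos (sub_pos.2 hnu) (mul_pos (mul_pos (hwpos 0) (hpos 0)) (hm 0))
  have step (k : ℕ) : c * (1 / (b k (k + 1) * u k * u (k + 1))) ≤
      w k / u k - w (k + 1) / u (k + 1) := by
    have h1 := hpos k
    have h2 := hpos (k + 1)
    have h3 := hb k
    have hW := wronskian_eq_sum hsymm hm hw hu k
    have hs : w 0 * u 0 * m 0 ≤ ∑ k ∈ Finset.range (k + 1), w k * u k * m k :=
      Finset.single_le_sum (f := fun k => w k * u k * m k)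
        (fun i _ => (mul_pos (mul_pos (hwpos i) (hpos i)) (hm i)).le) (by simp)
    have hs' := mul_le_mul_of_nonneg_left hs (sub_pos.2 hnu).le
    rw [← hW, ← hc] at hs'
    rw [div_sub_div _ _ h1.ne' h2.ne', mul_one_div, div_le_div_iff₀ (by positivity) (by positivity)]
    calc c * (u k * u (k + 1)) ≤
        b k (k + 1) * (w k * u (k + 1) - u k * w (k + 1)) * (u k * u (k + 1)) := by gcongr
      _ = _ := by ring
  refine ⟨(w 0 / u 0) / c, fun n => ?_⟩
  rw [le_div_iff₀' hcpos, Finset.mul_sum]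
  calc _ ≤ ∑ k ∈ Finset.range n, (w k / u k - w (k + 1) / u (k + 1)) :=
        Finset.sum_le_sum fun k _ => step k
    _ = w 0 / u 0 - w n / u n := Finset.sum_range_sub' (fun k => w k / u k) n
    _ ≤ w 0 / u 0 := sub_le_self _ (div_pos (hwpos n) (hpos n)).le

/-- Below the lower bound of the form, a square summable positive eigensolution dominates,
up to a constant, every positive eigensolution of any other eigenvalue. -/
lemma SemiboundedBelow.exists_le_const_mul {K : ℝ} (hsb : SemiboundedBelow b m W K)
    (hsymm : ∀ x y, b x y = b y x) (hb : ∀ x, 0 < b x (x + 1)) (hm : ∀ x, 0 < m x)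
    {lam mu : ℝ} (hmu : mu < K) {u v : ℕ → ℝ}
    (hu : ∀ x, lap b m u x + W x * u x = mu * u x) (hupos : ∀ x, 0 < u x)
    (hsum : Summable fun x => u x ^ 2 * m x)
    (hv : ∀ x, lap b m v x + W x * v x = lam * v x) (hvpos : ∀ x, 0 < v x) :
    ∃ C, ∀ x, v x ≤ C * u x := by
  have hW := wronskian_eq_sum hsymm hm hu hv
  have hnn (n : ℕ) : 0 ≤ ∑ k ∈ Finset.range n, u k * v k * m k :=
    Finset.sum_nonneg fun k _ => (mul_pos (mul_pos (hupos k) (hvpos k)) (hm k)).le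
  rcases le_or_gt mu lam with h | h
  · refine ⟨v 0 / u 0, fun x => ?_⟩
    have hanti : Antitone fun x => v x / u x := antitone_nat_of_succ_le fun x => by
      rw [div_le_div_iff₀ (hupos _) (hupos _)]
      have := mul_nonpos_of_nonpos_of_nonneg (sub_nonpos.2 h) (hnn (x + 1))
      rw [← hW x] at this
      have := nonpos_of_mul_nonpos_right this (hb x)
      linarith
    rw [← div_le_iff₀ (hupos x)]
    exact hanti (Nat.zero_le x)
  · obtain ⟨R, hR⟩ := hsb.exists_resistance_le hsymm hb hm hmu hu hupos
    set T := ∑' x, u x ^ 2 * m x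
    have hT : 0 ≤ T := tsum_nonneg fun x => mul_nonneg (sq_nonneg _) (hm x).le
    have hD : 0 ≤ (mu - lam) * T := mul_nonneg (sub_pos.2 h).le hT
    have hmono : Monotone fun x => v x / u x := monotone_nat_of_le_succ fun x => by
      rw [div_le_div_iff₀ (hupos _) (hupos _)]
      have := mul_nonneg (sub_pos.2 h).le (hnn (x + 1))
      rw [← hW x] at this
      have := nonneg_of_mul_nonneg_right this (hb x)
      linarith
    have hsumle (x : ℕ) : ∑ k ∈ Finset.range (x + 1), u k * v k * m k ≤ T * (v x / u x) := by
      calc _ ≤ ∑ k ∈ Finset.range (x + 1), u k ^ 2 * m k * (v x / u x) := by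
            refine Finset.sum_le_sum fun k hk => ?_
            have hk : v k / u k ≤ v x / u x := hmono (by simpa [Nat.lt_succ_iff] using hk)
            have h1 := hupos k
            have h2 := (hm k).le
            calc u k * v k * m k = u k ^ 2 * m k * (v k / u k) := by field_simp
              _ ≤ _ := by gcongr
        _ ≤ _ := by
            rw [← Finset.sum_mul]
            have := (div_pos (hvpos x) (hupos x)).le
            gcongr
            exact hsum.sum_le_tsum _ fun k _ => mul_nonneg (sq_nonneg _) (hm k).le
    have hstep (x : ℕ) : v (x + 1) / u (x + 1) ≤
        v x / u x * (1 + (mu - lam) * T * (1 / (b x (x + 1) * u x * u (x + 1)))) := by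
      have h1 := hupos x
      have h2 := hupos (x + 1)
      have h3 := hb x
      have hle := mul_le_mul_of_nonneg_left (hsumle x) (sub_pos.2 h).le
      rw [← hW x] at hle
      have heq : v (x + 1) / u (x + 1) = v x / u x +
          b x (x + 1) * (u x * v (x + 1) - v x * u (x + 1)) *
            (1 / (b x (x + 1) * u x * u (x + 1))) := by
        field_simp
        ring
      rw [heq, mul_add, mul_one]
      calc _ ≤ v x / u x + (mu - lam) * (T * (v x / u x)) *
            (1 / (b x (x + 1) * u x * u (x + 1))) := by gcongr
        _ = _ := by ring
    have hexp (x : ℕ) : v x / u x ≤ v 0 / u 0 * Real.exp ((mu - lam) * T *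
        ∑ k ∈ Finset.range x, 1 / (b k (k + 1) * u k * u (k + 1))) := by
      induction x with
      | zero => simp
      | succ x ih =>
        have h0 := (div_pos (hvpos x) (hupos x)).le
        rw [Finset.sum_range_succ, mul_add, Real.exp_add, ← mul_assoc]
        refine (hstep x).trans ?_
        calc _ ≤ v x / u x *
              Real.exp ((mu - lam) * T * (1 / (b x (x + 1) * u x * u (x + 1)))) := by
              gcongr
              rw [add_comm]
              exact Real.add_one_le_exp _
          _ ≤ _ := by gcongr
    refine ⟨v 0 / u 0 * Real.exp ((mu - lam) * T * R), fun x => ?_⟩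
    rw [← div_le_iff₀ (hupos x)]
    refine (hexp x).trans ?_
    have := (div_pos (hvpos 0) (hupos 0)).le
    gcongr
    exact hR x

/-- An eigensolution vanishing at the root is zero, provided a positive eigensolution exists. -/
lemma eq_zero_of_apply_zero_eq_zero (hsymm : ∀ x y, b x y = b y x)
    (hb : ∀ x, 0 < b x (x + 1)) (hm : ∀ x, 0 < m x) {lam mu : ℝ} {u v : ℕ → ℝ}
    (hu : ∀ x, lap b m u x + W x * u x = mu * u x)
    (hv : ∀ x, lap b m v x + W x * v x = lam * v x) (hvpos : ∀ x, 0 < v x) (h0 : u 0 = 0) :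
    u = 0 := by
  funext x
  induction x using Nat.strong_induction_on with
  | _ n ih =>
    cases n with
    | zero => exact h0
    | succ n =>
      have h := wronskian_eq_sum hsymm hm hu hv n
      rw [Finset.sum_eq_zero fun k hk => by
        rw [ih k (by simpa using hk)]; simp, ih n (by omega)] at h
      simpa [(hb n).ne', (hvpos n).ne'] using h

end BirthDeath

/-- Essential self-adjointness of a semi-bounded Schrödinger operator is characterized by
a weighted Hamburger-type series built from a positive eigensolution `v`. -/
theorem esa_iff_weighted_series_diverges
    (b : ℕ → ℕ → ℝ) (m : ℕ → ℝ)
    (hsymm : ∀ x y, b x y = b y x)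
    (hnonneg : ∀ x y, 0 ≤ b x y)
    (hedge : ∀ x y, 0 < b x y ↔ (x = y + 1 ∨ y = x + 1))
    (hm : ∀ x, 0 < m x)
    (W : ℕ → ℝ) (K : ℝ) (hsb : SemiboundedBelow b m W K)
    (lam : ℝ) (hlam : lam < K)
    (v : ℕ → ℝ) (hv : ∀ x, 0 < v x)
    (heig : ∀ x, lap b m v x + W x * v x = lam * v x) :
    (¬ Summable (fun r =>
        (∑ k ∈ Finset.range (r + 1), 1 / (b k (k + 1) * v k * v (k + 1))) ^ 2
          * v (r + 1) ^ 2 * m (r + 1)))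
    ↔ (∀ mu : ℝ, mu < K → ∀ u : ℕ → ℝ,
        Summable (fun x => u x ^ 2 * m x) →
        (∀ x, lap b m u x + W x * u x = mu * u x) → u = 0) := by
  have hb (x : ℕ) : 0 < b x (x + 1) := (hedge x (x + 1)).2 (Or.inr rfl)
  have ha (k : ℕ) : 0 < 1 / (b k (k + 1) * v k * v (k + 1)) :=
    one_div_pos.2 (mul_pos (mul_pos (hb k) (hv k)) (hv (k + 1)))
  constructor
  · intro hF mu hmu u hsum hu
    by_contra hne
    have h0 : u 0 ≠ 0 := fun h0 =>
      hne (eq_zero_of_apply_zero_eq_zero hsymm hb hm hu heig hv h0)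
    let w : ℕ → ℝ := fun x => (u 0)⁻¹ * u x
    have hw (x : ℕ) : lap b m w x + W x * w x = mu * w x := by
      rw [lap_const_mul]
      linear_combination (u 0)⁻¹ * hu x
    have hwpos := hsb.eigensolution_pos hb hm hmu hw (by simp [w, h0])
    have hwsum : Summable fun x => w x ^ 2 * m x :=
      (hsum.mul_left ((u 0)⁻¹ ^ 2)).congr fun x => by simp only [w]; ring
    obtain ⟨C, hC⟩ := hsb.exists_le_const_mul hsymm hb hm hmu hw hwpos hwsum heig hv
    obtain ⟨R, hR⟩ := hsb.exists_resistance_le hsymm hb hm hlam heig hv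
    refine hF (Summable.of_nonneg_of_le
      (fun r => mul_nonneg (mul_nonneg (sq_nonneg _) (sq_nonneg _)) (hm _).le) (fun r => ?_)
      (((summable_nat_add_iff 1).2 hwsum).mul_left (R ^ 2 * C ^ 2)))
    have hS : 0 ≤ ∑ k ∈ Finset.range (r + 1), 1 / (b k (k + 1) * v k * v (k + 1)) :=
      Finset.sum_nonneg fun k _ => (ha k).le
    have h1 := hR (r + 1)
    have h2 := hC (r + 1)
    have h3 := (hm (r + 1)).le
    have h4 := (hv (r + 1)).le
    calc _ ≤ R ^ 2 * (C * w (r + 1)) ^ 2 * m (r + 1) := by gcongr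
      _ = _ := by ring
  · intro h2 hF
    have hvsum : Summable fun x => v x ^ 2 * m x := by
      rw [← summable_nat_add_iff 1]
      set a := 1 / (b 0 (0 + 1) * v 0 * v (0 + 1))
      have ha0 : 0 < a := ha 0
      refine Summable.of_nonneg_of_le (fun r => mul_nonneg (sq_nonneg _) (hm _).le) (fun r => ?_)
        (hF.mul_left (a ^ 2)⁻¹)
      have hS : a ≤ ∑ k ∈ Finset.range (r + 1), 1 / (b k (k + 1) * v k * v (k + 1)) :=
        Finset.single_le_sum (f := fun k => 1 / (b k (k + 1) * v k * v (k + 1)))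
          (fun k _ => (ha k).le) (by simp)
      have h3 := (hm (r + 1)).le
      rw [le_inv_mul_iff₀ (by positivity), ← mul_assoc]
      gcongr
    exact (hv 0).ne' (congrFun (h2 lam hlam v hvsum heig) 0)
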